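/- Let X be a normed space and Θ ⊆ X nonempty compact. Let 𝒰 be the set of bounded functions u : [0,∞) → ℝ, with ‖u‖∞ := sup_{t≥0}|u(t)|, and for each u ∈ 𝒰 let φ_u : [0,∞) × X → X satisfy: (a) φ_u(0,x) = x for all x; (b) t ↦ φ_u(t,x) is continuous for every x; (c) the cocycle identity φ_u(t+τ, x) = φ_{u(·+τ)}(t, φ_u(τ,x)) for all t,τ ≥ 0 and x ∈ X. Suppose there exist r₀ > 0, a function V : {x ∈ X : dist(x,Θ) ≤ r₀} → [0,∞) with |V(x) − V(y)| ≤ ‖x−y‖, comparison functions ψ̲, ψ̄ ∈ 𝒦∞ with ψ̲(dist(x,Θ)) ≤ V(x) ≤ ψ̄(dist(x,Θ)) for all x with dist(x,Θ) ≤ r₀, and α, σ ∈ 𝒦∞ such that for every u ∈ 𝒰 and every x with dist(x,Θ) < r₀: limsup_{t→0+} ( V(φ_u(t,x)) − V(x) )/t ≤ −α(dist(x,Θ)) + σ(‖u‖∞). Then the family (φ_u) is locally input-to-state stable with respect to Θ: there exist β ∈ 𝒦ℒ, γ ∈ 𝒦, and radii r_{0x}, r_{0u} > 0 such that dist(φ_u(t,x),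 Θ) ≤ β(dist(x,Θ), t) + γ(‖u‖∞) for all t ≥ 0, whenever dist(x,Θ) ≤ r_{0x} and ‖u‖∞ ≤ r_{0u}. -/

import Mathlib

/-- A comparison function of class 𝒦: continuous and strictly increasing on [0,∞) with γ(0)=0. -/
def IsKFun (γ : ℝ → ℝ) : Prop :=
  ContinuousOn γ (Set.Ici 0) ∧ StrictMonoOn γ (Set.Ici 0) ∧ γ 0 = 0

/-- Class 𝒦∞: a 𝒦 function that is unbounded. -/
def IsKInfFun (γ : ℝ → ℝ) : Prop :=
  IsKFun γ ∧ Filter.Tendsto γ Filter.atTop Filter.atTop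

/-- A comparison function of class 𝒦ℒ. -/
def IsKLFun (β : ℝ → ℝ → ℝ) : Prop :=
  ContinuousOn (fun p : ℝ × ℝ => β p.1 p.2) (Set.Ici 0 ×ˢ Set.Ici 0) ∧
  (∀ t : ℝ, 0 ≤ t → IsKFun fun s => β s t) ∧
  (∀ s : ℝ, 0 < s → StrictAntiOn (β s) (Set.Ici 0) ∧
    Filter.Tendsto (β s) Filter.atTop (nhds 0))

/-- The sup-norm of a disturbance u : [0,∞) → ℝ. -/
noncomputable def supNorm (u : ℝ → ℝ) : ℝ :=
  sSup ((fun t => |u t|) '' Set.Ici 0)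

namespace IsKFun

variable {f g : ℝ → ℝ}

lemma lt_iff_lt (hf : IsKFun f) {x y : ℝ} (hx : 0 ≤ x) (hy : 0 ≤ y) : f x < f y ↔ x < y :=
  hf.2.1.lt_iff_lt hx hy

lemma le_iff_le (hf : IsKFun f) {x y : ℝ} (hx : 0 ≤ x) (hy : 0 ≤ y) : f x ≤ f y ↔ x ≤ y :=
  hf.2.1.le_iff_le hx hy

lemma nonneg (hf : IsKFun f) {x : ℝ} (hx : 0 ≤ x) : 0 ≤ f x := by
  rw [← hf.2.2]
  exact (hf.le_iff_le le_rfl hx).2 hx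

lemma pos (hf : IsKFun f) {x : ℝ} (hx : 0 < x) : 0 < f x := by
  rw [← hf.2.2]
  exact (hf.lt_iff_lt le_rfl hx.le).2 hx

lemma comp (hf : IsKFun f) (hg : IsKFun g) : IsKFun fun s => f (g s) :=
  ⟨hf.1.comp hg.1 fun _ hx => hg.nonneg hx,
    fun _ hx _ hy hxy => hf.2.1 (hg.nonneg hx) (hg.nonneg hy) (hg.2.1 hx hy hxy),
    by simp only [hg.2.2, hf.2.2]⟩

lemma const_mul (hf : IsKFun f) {c : ℝ} (hc : 0 < c) : IsKFun fun s => c * f s :=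
  ⟨continuousOn_const.mul hf.1,
    fun _ hx _ hy hxy => mul_lt_mul_of_pos_left (hf.2.1 hx hy hxy) hc,
    by simp only [hf.2.2, mul_zero]⟩

end IsKFun

/-- A class 𝒦∞ function has an inverse of class 𝒦∞. -/
lemma IsKInfFun.exists_inverse {f : ℝ → ℝ} (hf : IsKInfFun f) :
    ∃ g : ℝ → ℝ, IsKInfFun g ∧ (∀ s, 0 ≤ s → f (g s) = s) ∧ ∀ s, 0 ≤ s → g (f s) = s := by
  obtain ⟨hK, hlim⟩ := hf
  set F : ℝ → ℝ := fun x => f (max x 0) + min x 0 with hF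
  have hFpos : ∀ x, 0 ≤ x → F x = f x := fun x hx => by simp [hF, hx]
  have hFneg : ∀ x, x ≤ 0 → F x = x := fun x hx => by simp [hF, hx, hK.2.2]
  have hmono : StrictMono F := by
    intro x y hxy
    rcases le_or_gt 0 x with hx | hx
    · rw [hFpos x hx, hFpos y (hx.trans hxy.le)]
      exact (hK.lt_iff_lt hx (hx.trans hxy.le)).2 hxy
    · rw [hFneg x hx.le]
      rcases le_or_gt 0 y with hy | hy
      · rw [hFpos y hy]
        exact hx.trans_le (hK.nonneg hy)
      · rwa [hFneg y hy.le]
  have hcont : Continuous F :=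
    (hK.1.comp_continuous (by fun_prop) fun x => le_max_right x 0).add (by fun_prop)
  have hsurj : Function.Surjective F := by
    refine hcont.surjective ?_ ?_
    · refine hlim.congr' ?_
      filter_upwards [Filter.eventually_ge_atTop 0] with x hx using (hFpos x hx).symm
    · refine Filter.tendsto_id.congr' ?_
      filter_upwards [Filter.eventually_le_atBot 0] with x hx using (hFneg x hx).symm
  set e := hmono.orderIsoOfSurjective F hsurj
  have hFe : ∀ s, F (e.symm s) = s := fun s => e.apply_symm_apply s
  have heF : ∀ s, e.symm (F s) = s := fun s => e.symm_apply_apply s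
  have he0 : e.symm 0 = 0 := by
    have h := heF 0
    rwa [hFneg 0 le_rfl] at h
  have hnn : ∀ s, 0 ≤ s → 0 ≤ e.symm s := fun s hs => by
    rw [← he0]
    exact e.symm.monotone hs
  refine ⟨e.symm, ⟨⟨e.symm.continuous.continuousOn, e.symm.strictMono.strictMonoOn _, he0⟩,
    e.symm.tendsto_atTop⟩, fun s hs => ?_, fun s hs => ?_⟩
  · rw [← hFpos _ (hnn s hs), hFe]
  · rw [← hFpos s hs, heF]

/-- The solution `w = β s t` of `f w + t * b w = g s` is a class 𝒦ℒ function of `(s, t)`. -/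
lemma exists_isKLFun_solution {f b g : ℝ → ℝ} (hf : IsKInfFun f) (hb : IsKFun b)
    (hg : IsKFun g) :
    ∃ β : ℝ → ℝ → ℝ, IsKLFun β ∧ ∀ s, 0 ≤ s → ∀ t, 0 ≤ t → ∀ w, 0 ≤ w →
      f w + t * b w ≤ g s → w ≤ β s t := by
  have hH : ∀ t, 0 ≤ t → IsKInfFun fun w => f w + t * b w := fun t ht => by
    refine ⟨⟨hf.1.1.add (continuousOn_const.mul hb.1), fun x hx y hy hxy => ?_, ?_⟩, ?_⟩
    · have h₁ := hf.1.2.1 hx hy hxy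
      have h₂ := mul_le_mul_of_nonneg_left (hb.2.1 hx hy hxy).le ht
      exact add_lt_add_of_lt_of_le h₁ h₂
    · simp only [hf.1.2.2, hb.2.2, mul_zero, add_zero]
    · refine Filter.tendsto_atTop_mono' _ ?_ hf.2
      filter_upwards [Filter.eventually_ge_atTop 0] with w hw
      have := mul_nonneg ht (hb.nonneg hw)
      linarith
  have hex : ∀ s t, ∃ w, 0 ≤ s → 0 ≤ t → 0 ≤ w ∧ f w + t * b w = g s := by
    intro s t
    by_cases hst : 0 ≤ s ∧ 0 ≤ t
    · obtain ⟨k, hk, hk₁, -⟩ := (hH t hst.2).exists_inverse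
      exact ⟨k (g s), fun hs ht => ⟨hk.1.nonneg (hg.nonneg hs), hk₁ _ (hg.nonneg hs)⟩⟩
    · exact ⟨0, fun hs ht => absurd ⟨hs, ht⟩ hst⟩
  choose β hβ using hex
  have hlt : ∀ s, 0 ≤ s → ∀ t, 0 ≤ t → ∀ w, 0 ≤ w →
      (β s t < w ↔ g s < f w + t * b w) := fun s hs t ht w hw => by
    rw [← (hβ s t hs ht).2]
    exact ((hH t ht).1.lt_iff_lt (hβ s t hs ht).1 hw).symm
  have hgt : ∀ s, 0 ≤ s → ∀ t, 0 ≤ t → ∀ w, 0 ≤ w →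
      (w < β s t ↔ f w + t * b w < g s) := fun s hs t ht w hw => by
    rw [← (hβ s t hs ht).2]
    exact ((hH t ht).1.lt_iff_lt hw (hβ s t hs ht).1).symm
  have hcont : ContinuousOn (fun p : ℝ × ℝ => β p.1 p.2) (Set.Ici 0 ×ˢ Set.Ici 0) := by
    rintro ⟨s, t⟩ ⟨hs, ht⟩
    have hgc : Filter.Tendsto (fun p : ℝ × ℝ => g p.1)
        (nhdsWithin (s, t) (Set.Ici 0 ×ˢ Set.Ici 0)) (nhds (g s)) :=
      (hg.1.comp continuousOn_fst fun p hp => hp.1) (s, t) ⟨hs, ht⟩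
    have hHc : ∀ w, Filter.Tendsto (fun p : ℝ × ℝ => f w + p.2 * b w)
        (nhdsWithin (s, t) (Set.Ici 0 ×ˢ Set.Ici 0)) (nhds (f w + t * b w)) := fun w =>
      (Continuous.tendsto (by fun_prop : Continuous fun p : ℝ × ℝ => f w + p.2 * b w)
        (s, t)).mono_left nhdsWithin_le_nhds
    refine tendsto_order.2 ⟨fun w hw => ?_, fun w hw => ?_⟩
    · rcases lt_or_ge w 0 with hw0 | hw0
      · filter_upwards [self_mem_nhdsWithin] with p hp
        exact hw0.trans_le (hβ _ _ hp.1 hp.2).1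
      · filter_upwards [self_mem_nhdsWithin,
          (hHc w).eventually_lt hgc ((hgt s hs t ht w hw0).1 hw)] with p hp hpw
        exact (hgt _ hp.1 _ hp.2 w hw0).2 hpw
    · have hw0 : 0 ≤ w := (hβ s t hs ht).1.trans hw.le
      filter_upwards [self_mem_nhdsWithin,
        hgc.eventually_lt (hHc w) ((hlt s hs t ht w hw0).1 hw)] with p hp hpw
      exact (hlt _ hp.1 _ hp.2 w hw0).2 hpw
  refine ⟨β, ⟨hcont, fun t ht => ⟨?_, fun s hs s' hs' hss' => ?_, ?_⟩, fun s hs => ⟨?_, ?_⟩⟩,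
    fun s hs t ht w hw hle => ?_⟩
  · exact hcont.comp (f := fun s : ℝ => (s, t)) (by fun_prop) fun s hs => ⟨hs, ht⟩
  · refine (hgt s' hs' t ht _ (hβ s t hs ht).1).2 ?_
    rw [(hβ s t hs ht).2]
    exact hg.2.1 hs hs' hss'
  · refine le_antisymm (not_lt.1 fun h => ?_) (hβ 0 t le_rfl ht).1
    rw [hgt 0 le_rfl t ht 0 le_rfl, hf.1.2.2, hb.2.2, hg.2.2] at h
    simp at h
  · intro t ht t' ht' htt'
    have hw : 0 < β s t := by
      rw [hgt s hs.le t ht 0 le_rfl, hf.1.2.2, hb.2.2, mul_zero, add_zero]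
      exact hg.pos hs
    refine (hlt s hs.le t' ht' _ hw.le).2 ?_
    rw [← (hβ s t hs.le ht).2]
    have := mul_lt_mul_of_pos_right htt' (hb.pos hw)
    linarith
  · refine tendsto_order.2 ⟨fun w hw => ?_, fun w hw => ?_⟩
    · filter_upwards [Filter.eventually_ge_atTop 0] with t ht
      exact hw.trans_le (hβ s t hs.le ht).1
    · filter_upwards [Filter.eventually_ge_atTop 0,
        (Filter.tendsto_id.atTop_mul_const (hb.pos hw)).eventually_gt_atTop (g s)] with t ht hgt'
      refine (hlt s hs.le t ht w hw.le).2 ?_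
      have := hf.1.nonneg hw.le
      simp only [id] at hgt'
      linarith
  · exact not_lt.1 fun h => ((hlt s hs t ht w hw).1 h).not_ge hle

lemma supNorm_nonneg (u : ℝ → ℝ) : 0 ≤ supNorm u :=
  Real.sSup_nonneg fun _ ⟨_, _, h⟩ => h ▸ abs_nonneg _

lemma image_abs_shift_subset (u : ℝ → ℝ) {τ : ℝ} (hτ : 0 ≤ τ) :
    (fun t => |u (t + τ)|) '' Set.Ici 0 ⊆ (fun t => |u t|) '' Set.Ici 0 := by
  rintro _ ⟨t, ht, rfl⟩
  exact ⟨t + τ, add_nonneg ht hτ, rfl⟩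

lemma supNorm_shift_le {u : ℝ → ℝ} (hu : BddAbove ((fun t => |u t|) '' Set.Ici 0)) {τ : ℝ}
    (hτ : 0 ≤ τ) : supNorm (fun t => u (t + τ)) ≤ supNorm u :=
  csSup_le_csSup hu (Set.nonempty_Ici.image _) (image_abs_shift_subset u hτ)

/-- A real upper limit that is bounded by a negative number is a genuine one. -/
lemma eventually_lt_of_limsup_neg {ι : Type*} {l : Filter ι} {f : ι → ℝ} {a r : ℝ}
    (h : Filter.limsup f l ≤ a) (ha : a < 0) (hr : a < r) : ∀ᶠ i in l, f i < r := by
  rw [Filter.limsup_eq] at h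
  have hne : {c | ∀ᶠ i in l, f i ≤ c}.Nonempty := by
    by_contra hemp
    rw [Set.not_nonempty_iff_eq_empty.1 hemp, Real.sInf_empty] at h
    exact absurd h ha.not_ge
  obtain ⟨c, hc, hcr⟩ := exists_lt_of_csInf_lt hne (h.trans_lt hr)
  exact Filter.Eventually.mono hc fun i hi => lt_of_le_of_lt hi hcr

/-- The upper right Dini derivative of `v` at `τ` is the limit superior of the shifted
difference quotients at `0`. -/
lemma eventually_slope_lt_of_shift {v : ℝ → ℝ} {τ r : ℝ}
    (h : ∀ᶠ t in nhdsWithin 0 (Set.Ioi 0), (v (t + τ) - v τ) / t < r) :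
    ∀ᶠ z in nhdsWithin τ (Set.Ioi τ), slope v τ z < r := by
  have hmap : Filter.Tendsto (fun z => z - τ) (nhdsWithin τ (Set.Ioi τ))
      (nhdsWithin 0 (Set.Ioi 0)) := by
    refine tendsto_nhdsWithin_iff.2 ⟨?_, ?_⟩
    · have : Continuous fun z : ℝ => z - τ := by fun_prop
      simpa using (this.tendsto τ).mono_left nhdsWithin_le_nhds
    · filter_upwards [self_mem_nhdsWithin] with z hz using sub_pos.2 (Set.mem_Ioi.1 hz)
  filter_upwards [hmap.eventually h] with z hz
  rwa [sub_add_cancel, ← slope_def_field] at hz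

/-- A scalar function whose difference quotients from the right are eventually negative at the
level `B` does not cross that level upwards. -/
lemma le_of_slope_neg_at_level {v : ℝ → ℝ} {p q B : ℝ} (hpq : p ≤ q)
    (hv : ContinuousOn v (Set.Icc p q)) (hp : v p ≤ B)
    (hB : ∀ τ ∈ Set.Ico p q, v τ = B →
      ∀ᶠ z in nhdsWithin τ (Set.Ioi τ), slope v τ z < 0) :
    v q ≤ B := by
  have hclosed : IsClosed ({τ | v τ ≤ B} ∩ Set.Icc p q) := by
    rw [Set.inter_comm]
    exact hv.preimage_isClosed_of_isClosed isClosed_Icc isClosed_Iic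
  refine hclosed.Icc_subset_of_forall_exists_gt hp ?_ (Set.right_mem_Icc.2 hpq)
  rintro τ ⟨hτB : v τ ≤ B, hτ⟩ y hy
  refine Filter.nonempty_of_mem (Filter.inter_mem ?_ (Ioc_mem_nhdsGT hy))
  rcases hτB.lt_or_eq with hlt | heq
  · have hev : ∀ᶠ z in nhdsWithin τ (Set.Icc p q), v z < B :=
      (hv τ (Set.Ico_subset_Icc_self hτ)).eventually_lt_const hlt
    have hev' : ∀ᶠ z in nhdsWithin τ (Set.Ioi τ), v z < B :=
      nhdsWithin_le_of_mem (Icc_mem_nhdsGT_of_mem hτ) hev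
    exact hev'.mono fun z hz => hz.le
  · filter_upwards [hB τ hτ heq, self_mem_nhdsWithin] with z hz hτz
    rw [slope_def_field, div_neg_iff] at hz
    have hpos : 0 < z - τ := sub_pos.2 hτz
    change v z ≤ B
    rcases hz with h | h <;> linarith [h.1, h.2]

/-- Theorem 3.3, abstract form: a family of cocycle solution maps (φ_u)
admitting a local input-to-state Lyapunov function V with respect to a nonempty compact set
Θ ⊆ X (1-Lipschitz on the ball {dist(·,Θ) ≤ r₀}, sandwiched between ψ̲(dist(·,Θ)) and
ψ̄(dist(·,Θ)) with ψ̲, ψ̄ ∈ 𝒦∞, and satisfying the Dini decay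
limsup_{t→0+} (V(φ_u(t,x)) − V(x))/t ≤ −α(dist(x,Θ)) + σ(‖u‖∞) with α, σ ∈ 𝒦∞) is locally
input-to-state stable w.r.t. Θ: there exist β ∈ 𝒦ℒ, γ ∈ 𝒦 and radii r_{0x}, r_{0u} > 0 such
that dist(φ_u(t,x),Θ) ≤ β(dist(x,Θ),t) + γ(‖u‖∞) whenever dist(x,Θ) ≤ r_{0x},
‖u‖∞ ≤ r_{0u} and t ≥ 0. -/
theorem stmt18 {X : Type*} [NormedAddCommGroup X] [NormedSpace ℝ X]
    (Θ : Set X) (hne : Θ.Nonempty) (hcomp : IsCompact Θ)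
    (φ : (ℝ → ℝ) → ℝ → X → X)
    (ha : ∀ u : ℝ → ℝ, BddAbove ((fun t => |u t|) '' Set.Ici 0) → ∀ x : X, φ u 0 x = x)
    (hb : ∀ u : ℝ → ℝ, BddAbove ((fun t => |u t|) '' Set.Ici 0) → ∀ x : X,
      ContinuousOn (fun t => φ u t x) (Set.Ici 0))
    (hcoc : ∀ u : ℝ → ℝ, BddAbove ((fun t => |u t|) '' Set.Ici 0) →
      ∀ t : ℝ, 0 ≤ t → ∀ τ : ℝ, 0 ≤ τ → ∀ x : X,
        φ u (t + τ) x = φ (fun s => u (s + τ)) t (φ u τ x))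
    (r₀ : ℝ) (hr₀ : 0 < r₀)
    (V : X → ℝ)
    (hVnn : ∀ x : X, Metric.infDist x Θ ≤ r₀ → 0 ≤ V x)
    (hVlip : ∀ x y : X, Metric.infDist x Θ ≤ r₀ → Metric.infDist y Θ ≤ r₀ →
      |V x - V y| ≤ ‖x - y‖)
    (ψ₁ ψ₂ : ℝ → ℝ) (hψ₁ : IsKInfFun ψ₁) (hψ₂ : IsKInfFun ψ₂)
    (hsand : ∀ x : X, Metric.infDist x Θ ≤ r₀ →
      ψ₁ (Metric.infDist x Θ) ≤ V x ∧ V x ≤ ψ₂ (Metric.infDist x Θ))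
    (α σ : ℝ → ℝ) (hα : IsKInfFun α) (hσ : IsKInfFun σ)
    (hdecay : ∀ u : ℝ → ℝ, BddAbove ((fun t => |u t|) '' Set.Ici 0) → ∀ x : X,
      Metric.infDist x Θ < r₀ →
      Filter.limsup (fun t => (V (φ u t x) - V x) / t) (nhdsWithin 0 (Set.Ioi 0)) ≤
        -α (Metric.infDist x Θ) + σ (supNorm u)) :
    ∃ (β : ℝ → ℝ → ℝ) (γ : ℝ → ℝ) (r0x r0u : ℝ),
      IsKLFun β ∧ IsKFun γ ∧ 0 < r0x ∧ 0 < r0u ∧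
      ∀ u : ℝ → ℝ, BddAbove ((fun t => |u t|) '' Set.Ici 0) → supNorm u ≤ r0u →
        ∀ x : X, Metric.infDist x Θ ≤ r0x → ∀ t : ℝ, 0 ≤ t →
          Metric.infDist (φ u t x) Θ ≤ β (Metric.infDist x Θ) t + γ (supNorm u) := by
  obtain ⟨χ₁, hχ₁, hψχ₁, -⟩ := hψ₁.exists_inverse
  obtain ⟨χ₂, hχ₂, hψχ₂, -⟩ := hψ₂.exists_inverse
  obtain ⟨αi, hαi, hααi, -⟩ := hα.exists_inverse
  obtain ⟨σi, hσi, hσσi, -⟩ := hσ.exists_inverse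
  set a : ℝ → ℝ := fun m => 2⁻¹ * α (χ₂ m) with ha_def
  have haK : IsKFun a := (hα.1.comp hχ₂.1).const_mul (by norm_num)
  set c : ℝ → ℝ := fun s => ψ₂ (αi (2 * σ s)) with hc_def
  have hcK : IsKFun c := hψ₂.1.comp (hαi.1.comp (hσ.1.const_mul two_pos))
  obtain ⟨β, hβ, hβle⟩ := exists_isKLFun_solution hψ₁ (haK.comp hψ₁.1) hψ₂.1
  set M := ψ₁ r₀ / 2 with hM_def
  have hψr₀ : 0 < ψ₁ r₀ := hψ₁.1.pos hr₀
  have hM : 0 < M := half_pos hψr₀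
  have hMr₀ : M < ψ₁ r₀ := half_lt_self hψr₀
  have hχM : 0 < χ₂ M := hχ₂.1.pos hM
  have hαM : 0 < α (χ₂ M) / 2 := half_pos (hα.1.pos hχM)
  refine ⟨β, fun s => χ₁ (c s), min (χ₂ M) (r₀ / 2), σi (α (χ₂ M) / 2), hβ, hχ₁.1.comp hcK,
    lt_min hχM (half_pos hr₀), hσi.1.pos hαM, ?_⟩
  intro u hu hun x hx t ht
  have hn := supNorm_nonneg u
  have hc0 : 0 ≤ c (supNorm u) := hcK.nonneg hn
  have h2σ : 0 ≤ 2 * σ (supNorm u) := mul_nonneg two_pos.le (hσ.1.nonneg hn)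
  have hcM : c (supNorm u) ≤ M := by
    have h₁ : σ (supNorm u) ≤ α (χ₂ M) / 2 := by
      rw [← hσσi _ hαM.le]
      exact (hσ.1.le_iff_le hn (hσi.1.nonneg hαM.le)).2 hun
    have h₂ : αi (2 * σ (supNorm u)) ≤ χ₂ M := by
      refine (hα.1.le_iff_le (hαi.1.nonneg h2σ) hχM.le).1 ?_
      rw [hααi _ h2σ]
      linarith
    rw [← hψχ₂ M hM.le]
    exact (hψ₂.1.le_iff_le (hαi.1.nonneg h2σ) hχM.le).2 h₂
  set d : ℝ → ℝ := fun τ => Metric.infDist (φ u τ x) Θ with hd_def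
  set v : ℝ → ℝ := fun τ => V (φ u τ x) with hv_def
  have hd0 : ∀ τ, 0 ≤ d τ := fun τ => Metric.infDist_nonneg
  have hdc : ContinuousOn d (Set.Ici 0) :=
    (Metric.continuous_infDist_pt Θ).comp_continuousOn (hb u hu x)
  have hVc : ContinuousOn V {y | Metric.infDist y Θ ≤ r₀} := by
    refine (LipschitzOnWith.of_dist_le_mul (K := 1) fun y hy z hz => ?_).continuousOn
    rw [Real.dist_eq, dist_eq_norm, NNReal.coe_one, one_mul]
    exact hVlip y z hy hz
  have hvc : ∀ p q, 0 ≤ p → (∀ τ ∈ Set.Icc p q, d τ ≤ r₀) → ContinuousOn v (Set.Icc p q) :=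
    fun p q hp hpq =>
      hVc.comp ((hb u hu x).mono fun τ hτ => hp.trans hτ.1) fun τ hτ => hpq τ hτ
  -- Where the Lyapunov function exceeds the gain level, it decays at rate `α (d τ) / 2`.
  have hslope : ∀ τ, 0 ≤ τ → d τ < r₀ → 0 < v τ → c (supNorm u) ≤ v τ →
      ∀ r, -(2⁻¹ * α (d τ)) < r → ∀ᶠ z in nhdsWithin τ (Set.Ioi τ), slope v τ z < r := by
    intro τ hτ hdτ hvτ hcτ r hr
    have hle : v τ ≤ ψ₂ (d τ) := (hsand _ hdτ.le).2
    have hdpos : 0 < d τ := by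
      refine (hd0 τ).lt_of_ne fun h => ?_
      rw [← h, hψ₂.1.2.2] at hle
      exact absurd hvτ hle.not_gt
    have hσα : 2 * σ (supNorm u) ≤ α (d τ) := by
      have h := (hψ₂.1.le_iff_le (hαi.1.nonneg h2σ) (hd0 τ)).1 (hcτ.trans hle)
      rw [← hααi _ h2σ]
      exact (hα.1.le_iff_le (hαi.1.nonneg h2σ) (hd0 τ)).2 h
    have hbdd : BddAbove ((fun s => |u (s + τ)|) '' Set.Ici 0) :=
      hu.mono (image_abs_shift_subset u hτ)
    have hshift : σ (supNorm fun s => u (s + τ)) ≤ σ (supNorm u) :=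
      (hσ.1.le_iff_le (supNorm_nonneg _) hn).2 (supNorm_shift_le hu hτ)
    have hαpos := hα.1.pos hdpos
    refine eventually_slope_lt_of_shift ?_
    have hlim := hdecay (fun s => u (s + τ)) hbdd (φ u τ x) hdτ
    have hev := eventually_lt_of_limsup_neg (a := -(2⁻¹ * α (d τ))) (r := r)
      (hlim.trans (by linarith)) (by linarith) hr
    filter_upwards [hev, self_mem_nhdsWithin] with z hz hz0
    rwa [← hcoc u hu z (le_of_lt hz0) τ hτ x] at hz
  -- Levels above the gain level are not crossed upwards.
  have hlevel : ∀ p q B, 0 ≤ p → p ≤ q → (∀ τ ∈ Set.Ico p q, d τ < r₀) → d q ≤ r₀ →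
      0 < B → c (supNorm u) ≤ B → v p ≤ B → v q ≤ B := by
    intro p q B hp hpq hlt hq hB hcB hvp
    refine le_of_slope_neg_at_level hpq (hvc p q hp fun τ hτ => ?_) hvp fun τ hτ hvB => ?_
    · rcases hτ.2.lt_or_eq with h | h
      · exact (hlt τ ⟨hτ.1, h⟩).le
      · rwa [h]
    · have hdτ := hlt τ hτ
      refine hslope τ (hp.trans hτ.1) hdτ (by rwa [hvB]) (by rwa [hvB]) 0 ?_
      have hχ : χ₂ B ≤ d τ := by
        refine (hψ₂.1.le_iff_le (hχ₂.1.nonneg hB.le) (hd0 τ)).1 ?_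
        rw [hψχ₂ B hB.le, ← hvB]
        exact (hsand _ hdτ.le).2
      have := hα.1.pos ((hχ₂.1.pos hB).trans_le hχ)
      linarith
  have hd0x : d 0 = Metric.infDist x Θ := by simp only [hd_def, ha u hu x]
  have hd0r : d 0 < r₀ := by
    rw [hd0x]
    linarith [hx.trans (min_le_right _ _)]
  have hv0M : v 0 ≤ M := by
    refine (hsand _ hd0r.le).2.trans ?_
    rw [← hψχ₂ M hM.le]
    refine (hψ₂.1.le_iff_le (hd0 0) hχM.le).2 ?_
    rw [hd0x]
    exact hx.trans (min_le_left _ _)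
  -- The trajectory never leaves the region where the Lyapunov function is controlled.
  have hstay : ∀ τ, 0 ≤ τ → d τ < r₀ := by
    intro T hT
    by_contra! hTr
    set S := Set.Icc 0 T ∩ d ⁻¹' Set.Ici r₀ with hS
    have hSc : IsClosed S :=
      (hdc.mono fun τ hτ => hτ.1).preimage_isClosed_of_isClosed isClosed_Icc isClosed_Ici
    have hSb : BddBelow S := ⟨0, fun τ hτ => hτ.1.1⟩
    have hmem : sInf S ∈ S := hSc.csInf_mem ⟨T, ⟨hT, le_rfl⟩, hTr⟩ hSb
    set q := sInf S
    have hbefore : ∀ τ ∈ Set.Ico 0 q, d τ < r₀ := fun τ hτ => by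
      by_contra! h
      exact absurd (csInf_le hSb (show τ ∈ S from ⟨⟨hτ.1, hτ.2.le.trans hmem.1.2⟩, h⟩))
        hτ.2.not_ge
    obtain ⟨τ, hτ, hτr⟩ := intermediate_value_Icc hmem.1.1
      (hdc.mono fun τ hτ => hτ.1) (show r₀ ∈ Set.Icc (d 0) (d q) from ⟨hd0r.le, hmem.2⟩)
    have hτq : τ = q := hτ.2.eq_of_not_lt fun h => (hbefore τ ⟨hτ.1, h⟩).ne hτr
    rw [hτq] at hτr
    have hvq : v q ≤ M := hlevel 0 q M le_rfl hmem.1.1 hbefore hτr.le hM hcM hv0M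
    have hψq : ψ₁ (d q) ≤ v q := (hsand _ hτr.le).1
    rw [hτr] at hψq
    linarith
  have hβ0 : 0 ≤ β (Metric.infDist x Θ) t := (hβ.2.1 t ht).nonneg Metric.infDist_nonneg
  have hγ0 : 0 ≤ χ₁ (c (supNorm u)) := hχ₁.1.nonneg hc0
  change d t ≤ _
  rcases le_or_gt (d t) (χ₁ (c (supNorm u))) with h | h
  · linarith
  suffices d t ≤ β (Metric.infDist x Θ) t by linarith
  have hψv : ψ₁ (d t) ≤ v t := (hsand _ (hstay t ht).le).1
  have hcv : c (supNorm u) < v t := by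
    refine lt_of_lt_of_le ?_ hψv
    rw [← hψχ₁ _ hc0]
    exact (hψ₁.1.lt_iff_lt hγ0 (hd0 t)).2 h
  have hvt : 0 < v t := hc0.trans_lt hcv
  have hback : ∀ τ ∈ Set.Icc 0 t, v t ≤ v τ := by
    intro τ hτ
    by_contra! hlt
    obtain ⟨B, hB₁, hB₂⟩ := exists_between (max_lt hlt hcv)
    have hcB := (le_max_right _ _).trans hB₁.le
    exact absurd (hlevel τ t B hτ.1 hτ.2 (fun s hs => hstay s (hτ.1.trans hs.1))
      (hstay t ht).le (hc0.trans_lt ((le_max_right _ _).trans_lt hB₁)) hcB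
      ((le_max_left _ _).trans hB₁.le)) hB₂.not_ge
  have hdecr : v t ≤ v 0 + -a (v t) * t := by
    refine image_le_of_liminf_slope_right_le_deriv_boundary
      (B := fun τ => v 0 + -a (v t) * τ) (B' := fun _ => -a (v t))
      (hvc 0 t le_rfl fun τ hτ => (hstay τ hτ.1).le) (by simp) (by fun_prop)
      (fun τ _ => ?_) (fun τ hτ r hr => ?_) (Set.right_mem_Icc.2 ht)
    · simpa using (((hasDerivAt_id τ).const_mul (-a (v t))).const_add (v 0)).hasDerivWithinAt
    · have hvτ := hback τ ⟨hτ.1, hτ.2.le⟩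
      have hdτ := hstay τ hτ.1
      refine (hslope τ hτ.1 hdτ (hvt.trans_le hvτ) (hcv.le.trans hvτ) r ?_).frequently
      have hχ : χ₂ (v t) ≤ d τ := by
        refine (hψ₂.1.le_iff_le (hχ₂.1.nonneg hvt.le) (hd0 τ)).1 ?_
        rw [hψχ₂ _ hvt.le]
        exact hvτ.trans (hsand _ hdτ.le).2
      have hα_le := (hα.1.le_iff_le (hχ₂.1.nonneg hvt.le) (hd0 τ)).2 hχ
      simp only [ha_def] at hr
      linarith
  refine hβle _ Metric.infDist_nonneg t ht _ (hd0 t) ?_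
  have ha_le : a (ψ₁ (d t)) ≤ a (v t) :=
    (haK.le_iff_le (hψ₁.1.nonneg (hd0 t)) hvt.le).2 hψv
  have hmul := mul_le_mul_of_nonneg_left ha_le ht
  have hv0 : v 0 ≤ ψ₂ (d 0) := (hsand _ hd0r.le).2
  rw [hd0x] at hv0
  linarith
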